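/- arXiv:2007.13532 — 3 statements merged into one kernel-verified Lean document; each statement's English description precedes it below -/
import Mathlib

section
/- Upper PAC-Bayes-λ relaxation (deterministic core): for any p̂ ∈ [0,1], p ∈ (0,1), and B ≥ 0, if kl(p̂‖p) ≤ B then for every λ ∈ (0,2): p ≤ p̂/(1 − λ/2) + B/(λ·(1 − λ/2)). -/
/-- KL divergence between Bernoulli distributions with biases `p` and `q`,
with the convention `0 · ln 0 = 0`. -/
noncomputable def klBin (p q : ℝ) : ℝ :=
  (if p = 0 then 0 else p * Real.log (p / q)) +
    (if p = 1 then 0 else (1 - p) * Real.log ((1 - p) / (1 - q)))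

theorem sub_le_mul_log_div {x y : ℝ} (hx : 0 ≤ x) (hy : 0 < y) :
    x - y ≤ x * Real.log (x / y) := by
  rcases hx.eq_or_lt with rfl | hx
  · simpa using hy.le
  · calc x - y = x * (1 - (x / y)⁻¹) := by field_simp
      _ ≤ x * Real.log (x / y) := by
        gcongr
        exact Real.one_sub_inv_le_log_of_pos (div_pos hx hy)

theorem exp_neg_le_one_sub_add_sq_div_two {x : ℝ} (hx : 0 ≤ x) :
    Real.exp (-x) ≤ 1 - x + x ^ 2 / 2 := by
  have h := Real.quadratic_le_exp_of_nonneg hx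
  have hpos : 0 < 1 + x + x ^ 2 / 2 := by positivity
  rw [Real.exp_neg]
  calc (Real.exp x)⁻¹ ≤ (1 + x + x ^ 2 / 2)⁻¹ := by gcongr
    _ ≤ 1 - x + x ^ 2 / 2 := by
      rw [inv_le_iff_one_le_mul₀ hpos]
      nlinarith [sq_nonneg (x ^ 2)]

theorem klBin_eq (p q : ℝ) :
    klBin p q = p * Real.log (p / q) + (1 - p) * Real.log ((1 - p) / (1 - q)) := by
  unfold klBin
  congr 1 <;> split_ifs with h <;> simp [h]

/-- A linearized form of the Donsker–Varadhan lower bound for Bernoulli distributions. -/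
theorem mul_one_sub_exp_neg_sub_le_klBin {a p : ℝ} (ha0 : 0 ≤ a) (ha1 : a ≤ 1)
    (hp0 : 0 < p) (hp1 : p < 1) (l : ℝ) :
    p * (1 - Real.exp (-l)) - l * a ≤ klBin a p := by
  have h0 := sub_le_mul_log_div ha0 (mul_pos hp0 (Real.exp_pos (-l)))
  have h1 := sub_le_mul_log_div (sub_nonneg.2 ha1) (sub_pos.2 hp1)
  have hlog : a * Real.log (a / (p * Real.exp (-l))) = a * Real.log (a / p) + l * a := by
    rcases ha0.eq_or_lt with rfl | ha
    · simp
    · rw [← div_div, Real.log_div (div_pos ha hp0).ne' (Real.exp_pos _).ne', Real.log_exp]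
      ring
  rw [klBin_eq]
  linarith

/-- Upper PAC-Bayes-λ relaxation (deterministic core): if `kl(p̂‖p) ≤ B` then for every
`λ ∈ (0,2)`, `p ≤ p̂/(1 - λ/2) + B/(λ (1 - λ/2))`. -/
theorem pac_bayes_lambda_upper_core
    (phat p B : ℝ) (hphat0 : 0 ≤ phat) (hphat1 : phat ≤ 1)
    (hp0 : 0 < p) (hp1 : p < 1) (hB : 0 ≤ B)
    (hkl : klBin phat p ≤ B) :
    ∀ l : ℝ, 0 < l → l < 2 →
      p ≤ phat / (1 - l / 2) + B / (l * (1 - l / 2)) := by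
  intro l hl0 hl2
  have hl : 0 < 1 - l / 2 := by linarith
  have hkl' := mul_one_sub_exp_neg_sub_le_klBin hphat0 hphat1 hp0 hp1 l
  have hexp := mul_le_mul_of_nonneg_left (exp_neg_le_one_sub_add_sq_div_two hl0.le) hp0.le
  have hsum : phat / (1 - l / 2) + B / (l * (1 - l / 2))
      = (l * phat + B) / (l * (1 - l / 2)) := by
    field_simp
  rw [hsum, le_div_iff₀ (mul_pos hl0 hl)]
  linarith
end

section
/- Lower PAC-Bayes-λ relaxation (deterministic core): for any p̂ ∈ [0,1], p ∈ (0,1), and B ≥ 0, if kl(p̂‖p) ≤ B then for every γ > 0: p ≥ (1 − γ/2)·p̂ − B/γ. -/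
/-- Second-order lower bound for `-log (1 - t)` from its power series. -/
lemma add_sq_div_two_le_neg_log_one_sub {t : ℝ} (ht0 : 0 ≤ t) (ht1 : t < 1) :
    t + t ^ 2 / 2 ≤ -Real.log (1 - t) := by
  have h := sum_le_hasSum (Finset.range 2) (fun n _ => by positivity)
    (Real.hasSum_pow_div_log_of_abs_lt_one (abs_lt.2 ⟨by linarith, ht1⟩))
  norm_num [Finset.sum_range_succ] at h
  linarith

/-- Refined Pinsker inequality for Bernoulli distributions, in the regime `p ≤ a`. -/
lemma sq_div_two_mul_le_klBin {a p : ℝ} (hp0 : 0 < p) (hpa : p ≤ a) (ha1 : a ≤ 1) (hp1 : p < 1) :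
    (a - p) ^ 2 / (2 * a) ≤ klBin a p := by
  have ha : 0 < a := hp0.trans_le hpa
  have hfirst : (a - p) + (a - p) ^ 2 / (2 * a) ≤ a * Real.log (a / p) := by
    have h := add_sq_div_two_le_neg_log_one_sub (t := (a - p) / a)
      (div_nonneg (by linarith) ha.le) ((div_lt_one ha).2 (by linarith))
    have hlog : -Real.log (1 - (a - p) / a) = Real.log (a / p) := by
      rw [← Real.log_inv, one_sub_div ha.ne', sub_sub_cancel, inv_div]
    rw [hlog] at h
    calc (a - p) + (a - p) ^ 2 / (2 * a)
        = a * ((a - p) / a + ((a - p) / a) ^ 2 / 2) := by field_simp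
      _ ≤ _ := by gcongr
  have hsecond : p - a ≤ if a = 1 then 0 else (1 - a) * Real.log ((1 - a) / (1 - p)) := by
    split_ifs with h1
    · linarith
    · have ha' : 0 < 1 - a := sub_pos.2 (lt_of_le_of_ne ha1 h1)
      have hp' : 0 < 1 - p := sub_pos.2 hp1
      calc p - a = (1 - a) * (1 - ((1 - a) / (1 - p))⁻¹) := by field_simp; ring
        _ ≤ _ := by
          gcongr
          exact Real.one_sub_inv_le_log_of_pos (div_pos ha' hp')
  rw [klBin, if_neg ha.ne']
  linarith

/-- Lower PAC-Bayes-λ relaxation (deterministic core): if `kl(p̂‖p) ≤ B` then for every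
`γ > 0`, `p ≥ (1 - γ/2) p̂ - B/γ`. -/
theorem pac_bayes_lambda_lower_core
    (phat p B : ℝ) (hphat0 : 0 ≤ phat) (hphat1 : phat ≤ 1)
    (hp0 : 0 < p) (hp1 : p < 1) (hB : 0 ≤ B)
    (hkl : klBin phat p ≤ B) :
    ∀ g : ℝ, 0 < g →
      (1 - g / 2) * phat - B / g ≤ p := by
  intro g hg
  have hBg : 0 ≤ B / g := div_nonneg hB hg.le
  rcases le_total phat p with h | h
  · nlinarith [mul_nonneg hg.le hphat0]
  · have ha : 0 < phat := hp0.trans_le h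
    have hdiv : (phat - p) ^ 2 / (2 * phat) / g ≤ B / g := by
      gcongr
      exact (sq_div_two_mul_le_klBin hp0 h hphat1 hp1).trans hkl
    have hsq : 0 ≤ (g * phat - (phat - p)) ^ 2 / (2 * phat * g) := by positivity
    have hexp : (g * phat - (phat - p)) ^ 2 / (2 * phat * g) =
        g * phat / 2 - (phat - p) + (phat - p) ^ 2 / (2 * phat) / g := by
      field_simp
      ring
    linarith
end

section
/- PAC-Bayesian disagreement bound for binary classification: for any prior distribution π on H with π(h) > 0 for all h, and any δ ∈ (0,1), with probability at least 1 − δ over the joint draw of the labeled sample S of size n from D and the unlabeled sample S' of size m from the marginal D_X (with S and S' independent), the following holds simultaneously for all weightings ρ on H, all λ ∈ (0,2), and all γ > 0: L(MV_ρ) ≤ 4·( E_ρ[L̂(h,S)]/(1 − λ/2) + (KL(ρ‖π) + ln(4√n/δ))/(λ·(1 − λ/2)·n) ) − 2·( (1 − γ/2)·E_{ρ²}[𝔻̂(h,h',S')] − (2·KL(ρ‖π) + ln(4√m/δ))/(γ·m) ). -/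
open MeasureTheory Finset

/-- The rising factorial `(1/2) (3/2) ⋯ (a - 1/2)`. -/
noncomputable def risingHalf (a : ℕ) : ℝ := ∏ i ∈ range a, ((i : ℝ) + 1 / 2)

theorem risingHalf_zero : risingHalf 0 = 1 := by simp [risingHalf]

theorem risingHalf_succ (a : ℕ) : risingHalf (a + 1) = risingHalf a * (a + 1 / 2) := by
  simp [risingHalf, prod_range_succ]

theorem risingHalf_pos (a : ℕ) : 0 < risingHalf a :=
  prod_pos fun i _ => by positivity

theorem sum_choose_mul_risingHalf (n : ℕ) :
    ∑ ij ∈ antidiagonal n, (n.choose ij.1 : ℝ) * (risingHalf ij.1 * risingHalf ij.2) =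
      n.factorial := by
  induction n with
  | zero => simp [risingHalf_zero]
  | succ n ih =>
    rw [Finset.sum_antidiagonal_choose_succ_mul (fun i j => risingHalf i * risingHalf j) n,
      ← sum_add_distrib, Nat.factorial_succ, Nat.cast_mul, ← ih, mul_sum]
    refine sum_congr rfl fun ij hij => ?_
    obtain ⟨i, j⟩ := ij
    rw [HasAntidiagonal.mem_antidiagonal] at hij
    simp only at hij ⊢
    rw [risingHalf_succ, risingHalf_succ, Nat.choose_symm_of_eq_add hij.symm, ← hij]
    push_cast
    ring

/-- Midpoint inequality for the concave function `log`, in exponential form. -/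
theorem succ_pow_succ_le_exp_mul (a : ℕ) (ha : 1 ≤ a) :
    ((a : ℝ) + 1) ^ (a + 1) ≤ Real.exp 1 * (a + 1 / 2) * (a : ℝ) ^ a := by
  have ha0 : (0 : ℝ) < a := by exact_mod_cast ha
  have hc : (0 : ℝ) < a + 1 / 2 := by positivity
  have hint : ∫ x in (a : ℝ)..(a + 1), Real.log x ≤
      ∫ x in (a : ℝ)..(a + 1), (Real.log (a + 1 / 2) + (x - (a + 1 / 2)) / (a + 1 / 2)) := by
    refine intervalIntegral.integral_mono_on (by linarith) intervalIntegral.intervalIntegrable_log'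
      (Continuous.intervalIntegrable (by fun_prop) _ _) fun x hx => ?_
    have hx0 : 0 < x := ha0.trans_le hx.1
    have h := Real.log_le_sub_one_of_pos (div_pos hx0 hc)
    rw [Real.log_div hx0.ne' hc.ne'] at h
    have : (x - (a + 1 / 2)) / (a + 1 / 2) = x / (a + 1 / 2) - 1 := by field_simp
    linarith
  have hval : ∫ x in (a : ℝ)..(a + 1),
      (Real.log (a + 1 / 2) + (x - (a + 1 / 2)) / (a + 1 / 2)) = Real.log (a + 1 / 2) := by
    rw [intervalIntegral.integral_add (by simp)
        (Continuous.intervalIntegrable (by fun_prop) _ _), intervalIntegral.integral_div,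
      intervalIntegral.integral_sub (by simp) (by simp), integral_id]
    have : ((a : ℝ) + 1) ^ 2 - (a : ℝ) ^ 2 = 2 * (a + 1 / 2) := by ring
    simp [this]
  rw [hval, integral_log] at hint
  rw [← Real.log_le_log_iff (by positivity) (by positivity), Real.log_mul (by positivity)
    (by positivity), Real.log_mul (by positivity) (by positivity), Real.log_exp, Real.log_pow,
    Real.log_pow]
  push_cast
  linarith

theorem half_exp_mul_self_pow_le {a : ℕ} (ha : 1 ≤ a) :
    Real.exp 1 / 2 * (a : ℝ) ^ a ≤ Real.exp a * risingHalf a := by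
  induction a, ha using Nat.le_induction with
  | base =>
    have := risingHalf_succ 0
    rw [risingHalf_zero] at this
    norm_num at this ⊢
    rw [this]
    linarith
  | succ a ha ih =>
    rw [risingHalf_succ]
    push_cast
    rw [Real.exp_add]
    calc Real.exp 1 / 2 * ((a : ℝ) + 1) ^ (a + 1)
        ≤ Real.exp 1 / 2 * (Real.exp 1 * (a + 1 / 2) * (a : ℝ) ^ a) := by
          gcongr
          exact succ_pow_succ_le_exp_mul a ha
      _ = Real.exp 1 * (a + 1 / 2) * (Real.exp 1 / 2 * (a : ℝ) ^ a) := by ring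
      _ ≤ Real.exp 1 * (a + 1 / 2) * (Real.exp a * risingHalf a) := by gcongr
      _ = _ := by ring

theorem self_pow_le_exp_mul_risingHalf (a : ℕ) : (a : ℝ) ^ a ≤ Real.exp a * risingHalf a := by
  rcases Nat.eq_zero_or_pos a with rfl | ha
  · simp [risingHalf_zero]
  · refine le_trans ?_ (half_exp_mul_self_pow_le ha)
    refine le_mul_of_one_le_left (by positivity) ?_
    linarith [Real.add_one_le_exp 1]

theorem factorial_mul_exp_le {n : ℕ} (hn : 1 ≤ n) :
    (n.factorial : ℝ) * Real.exp n ≤ Real.exp 1 * √n * (n : ℝ) ^ n := by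
  obtain ⟨k, rfl⟩ := Nat.exists_eq_add_of_le' hn
  have h := Stirling.stirlingSeq'_antitone (Nat.zero_le k)
  simp only [Function.comp_apply, Nat.succ_eq_add_one, zero_add, Stirling.stirlingSeq_one] at h
  rw [Stirling.stirlingSeq, div_le_div_iff₀ (by positivity) (by positivity), Real.sqrt_mul (by norm_num), div_pow,
    ← Real.exp_nat_mul, mul_one] at h
  have h2 : 0 < √(2 : ℝ) := by positivity
  have he : 0 < Real.exp ((k + 1 : ℕ) : ℝ) := Real.exp_pos _
  rw [← mul_div_assoc, ← mul_div_assoc, le_div_iff₀ he] at h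
  refine le_of_mul_le_mul_left ?_ h2
  linarith

/-- The Krichevsky–Trofimov estimator is within a factor `2 √n` of the maximum likelihood. -/
theorem self_pow_mul_self_pow_mul_factorial_le (a b : ℕ) (hab : 1 ≤ a + b) :
    (a : ℝ) ^ a * (b : ℝ) ^ b * (a + b).factorial ≤
      2 * √(a + b : ℕ) * ((a + b : ℕ) : ℝ) ^ (a + b) * (risingHalf a * risingHalf b) := by
  have key : Real.exp 1 / 2 * ((a : ℝ) ^ a * (b : ℝ) ^ b) ≤
      Real.exp (a + b : ℕ) * (risingHalf a * risingHalf b) := by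
    rw [Nat.cast_add, Real.exp_add]
    rcases Nat.eq_zero_or_pos a with rfl | ha
    · have := half_exp_mul_self_pow_le (a := b) (by omega)
      simpa [risingHalf_zero] using this
    · have := mul_le_mul (half_exp_mul_self_pow_le ha) (self_pow_le_exp_mul_risingHalf b)
        (by positivity) (mul_nonneg (by positivity) (risingHalf_pos a).le)
      linarith
  have hr := mul_pos (risingHalf_pos a) (risingHalf_pos b)
  have hf := factorial_mul_exp_le hab
  have he : 0 < Real.exp 1 / 2 := by positivity
  refine le_of_mul_le_mul_left ?_ he
  calc Real.exp 1 / 2 * ((a : ℝ) ^ a * (b : ℝ) ^ b * (a + b).factorial)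
      = Real.exp 1 / 2 * ((a : ℝ) ^ a * (b : ℝ) ^ b) * (a + b).factorial := by ring
    _ ≤ Real.exp (a + b : ℕ) * (risingHalf a * risingHalf b) * (a + b).factorial := by gcongr
    _ = (a + b).factorial * Real.exp (a + b : ℕ) * (risingHalf a * risingHalf b) := by ring
    _ ≤ Real.exp 1 * √(a + b : ℕ) * ((a + b : ℕ) : ℝ) ^ (a + b) *
        (risingHalf a * risingHalf b) := by gcongr
    _ = _ := by ring

/-- The maximal likelihood of `a` successes and `b` failures in `a + b` Bernoulli trials. -/
noncomputable def maxLikelihood (a b : ℕ) : ℝ :=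
  ((a : ℝ) / (a + b : ℕ)) ^ a * ((b : ℝ) / (a + b : ℕ)) ^ b

theorem maxLikelihood_pos (a b : ℕ) : 0 < maxLikelihood a b := by
  have h (c d : ℕ) (hcd : c ≤ d) : 0 < ((c : ℝ) / d) ^ c := by
    rcases Nat.eq_zero_or_pos c with rfl | hc
    · simp
    · have : 0 < d := by omega
      positivity
  exact mul_pos (h _ _ (by omega)) (h _ _ (by omega))

/-- Maurer's bound on the normalized maximum likelihood sum. -/
theorem sum_choose_mul_maxLikelihood_le {n : ℕ} (hn : 1 ≤ n) :
    ∑ ij ∈ antidiagonal n, (n.choose ij.1 : ℝ) * maxLikelihood ij.1 ij.2 ≤ 2 * √n := by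
  have hfac : (0 : ℝ) < n.factorial := by positivity
  refine le_of_mul_le_mul_right ?_ hfac
  calc _ = ∑ ij ∈ antidiagonal n,
        (n.choose ij.1 : ℝ) * (maxLikelihood ij.1 ij.2 * n.factorial) := by
        rw [sum_mul]; simp only [mul_assoc]
    _ ≤ ∑ ij ∈ antidiagonal n,
        (n.choose ij.1 : ℝ) * (2 * √n * (risingHalf ij.1 * risingHalf ij.2)) := by
        refine sum_le_sum fun ij hij => ?_
        obtain ⟨a, b⟩ := ij
        rw [HasAntidiagonal.mem_antidiagonal] at hij
        simp only at hij ⊢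
        subst hij
        refine mul_le_mul_of_nonneg_left ?_ (Nat.cast_nonneg _)
        have hpos : (0 : ℝ) < ((a + b : ℕ) : ℝ) ^ (a + b) := by positivity
        have h := self_pow_mul_self_pow_mul_factorial_le a b hn
        have hml : maxLikelihood a b * ((a + b : ℕ) : ℝ) ^ (a + b) =
            (a : ℝ) ^ a * (b : ℝ) ^ b := by
          have h0 : ((a + b : ℕ) : ℝ) ≠ 0 := by positivity
          rw [maxLikelihood, div_pow, div_pow, pow_add]
          field_simp
        refine le_of_mul_le_mul_right ?_ hpos
        calc _ = (a : ℝ) ^ a * (b : ℝ) ^ b * (a + b).factorial := by rw [← hml]; ring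
          _ ≤ _ := h
          _ = _ := by ring
    _ = 2 * √n * ∑ ij ∈ antidiagonal n,
        (n.choose ij.1 : ℝ) * (risingHalf ij.1 * risingHalf ij.2) := by
        rw [mul_sum]; exact sum_congr rfl fun _ _ => by ring
    _ = _ := by rw [sum_choose_mul_risingHalf]

theorem pow_mul_pow_le_maxLikelihood {a b : ℕ} (hab : 1 ≤ a + b) {x y : ℝ} (hx : 0 ≤ x)
    (hy : 0 ≤ y) : x ^ a * y ^ b ≤ maxLikelihood a b * (x + y) ^ (a + b) := by
  rcases Nat.eq_zero_or_pos a with rfl | ha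
  · have hb : (b : ℝ) ≠ 0 := Nat.cast_ne_zero.2 (by omega)
    simp only [maxLikelihood, zero_add, pow_zero, one_mul, div_self hb, one_pow]
    gcongr
    linarith
  rcases Nat.eq_zero_or_pos b with rfl | hb
  · have hb : (a : ℝ) ≠ 0 := by positivity
    simp only [maxLikelihood, add_zero, pow_zero, mul_one, div_self hb, one_pow, one_mul]
    gcongr
    linarith
  have ha' : (0 : ℝ) < a := by positivity
  have hb' : (0 : ℝ) < b := by positivity
  have hn : (0 : ℝ) < (a + b : ℕ) := by positivity
  set p : ℝ := a / (a + b : ℕ) with hp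
  set q : ℝ := b / (a + b : ℕ) with hq
  have hp0 : 0 < p := by positivity
  have hq0 : 0 < q := by positivity
  have hpq : p + q = 1 := by rw [hp, hq, ← add_div, ← Nat.cast_add, div_self hn.ne']
  have h := Real.geom_mean_le_arith_mean2_weighted hp0.le hq0.le (div_nonneg hx hp0.le)
    (div_nonneg hy hq0.le) hpq
  rw [mul_div_cancel₀ _ hp0.ne', mul_div_cancel₀ _ hq0.ne'] at h
  have h2 := pow_le_pow_left₀ (by positivity) h (a + b)
  have hpa : ((x / p) ^ p) ^ (a + b) = (x / p) ^ a := by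
    rw [← Real.rpow_mul_natCast (by positivity), hp, div_mul_cancel₀ _ hn.ne', Real.rpow_natCast]
  have hqb : ((y / q) ^ q) ^ (a + b) = (y / q) ^ b := by
    rw [← Real.rpow_mul_natCast (by positivity), hq, div_mul_cancel₀ _ hn.ne', Real.rpow_natCast]
  rw [mul_pow, hpa, hqb, div_pow x p, div_pow y q, div_mul_div_comm, div_le_iff₀ (by positivity)] at h2
  rw [maxLikelihood, ← hp, ← hq]
  linarith

theorem pow_mul_likelihood_le {a b : ℕ} (hab : 1 ≤ a + b) {p q t : ℝ} (hp : 0 ≤ p)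
    (hq : 0 ≤ q) (hpq : p + q = 1) (ht : 0 ≤ t) :
    t ^ a * (p ^ a * q ^ b) ≤ maxLikelihood a b * Real.exp ((a + b : ℕ) * (p * (t - 1))) := by
  have h := pow_mul_pow_le_maxLikelihood hab (mul_nonneg hp ht) hq
  have h2 : p * t + q ≤ Real.exp (p * (t - 1)) := by
    have := Real.add_one_le_exp (p * (t - 1))
    linarith
  have h3 := pow_le_pow_left₀ (by positivity) h2 (a + b)
  rw [← Real.exp_nat_mul] at h3
  calc _ = (p * t) ^ a * q ^ b := by rw [mul_pow]; ring
    _ ≤ _ := h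
    _ ≤ _ := by gcongr; exact (maxLikelihood_pos a b).le

theorem exp_mul_likelihood_le_upper {a b : ℕ} (hab : 1 ≤ a + b) {p q l : ℝ} (hp : 0 ≤ p)
    (hq : 0 ≤ q) (hpq : p + q = 1) (hl : 0 ≤ l) :
    Real.exp ((a + b : ℕ) * (l * (1 - l / 2) * p) - l * a) * (p ^ a * q ^ b) ≤
      maxLikelihood a b := by
  have h := pow_mul_likelihood_le hab hp hq hpq (Real.exp_pos (-l)).le
  have he : Real.exp (-l) ≤ 1 - l + l ^ 2 / 2 := by
    rw [Real.exp_neg]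
    refine inv_le_of_inv_le₀ (by nlinarith [sq_nonneg (l - 1)]) ?_
    refine le_trans ?_ (Real.quadratic_le_exp_of_nonneg hl)
    rw [inv_le_iff_one_le_mul₀ (by nlinarith [sq_nonneg (l - 1)])]
    nlinarith [sq_nonneg (l ^ 2)]
  rw [← Real.exp_nat_mul] at h
  have h2 : (a + b : ℕ) * (l * (1 - l / 2) * p) ≤
      -((a + b : ℕ) * (p * (Real.exp (-l) - 1))) := by
    rw [← mul_neg]
    gcongr
    nlinarith
  calc _ ≤ Real.exp (a * -l - (a + b : ℕ) * (p * (Real.exp (-l) - 1))) * (p ^ a * q ^ b) := by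
        refine mul_le_mul_of_nonneg_right (Real.exp_le_exp.2 ?_) (by positivity)
        linarith
    _ = Real.exp (a * -l) * (p ^ a * q ^ b) / Real.exp ((a + b : ℕ) * (p * (Real.exp (-l) - 1))) :=
        by rw [Real.exp_sub]; ring
    _ ≤ _ := by rwa [div_le_iff₀ (Real.exp_pos _)]

theorem exp_mul_likelihood_le_lower {a b : ℕ} (hab : 1 ≤ a + b) {p q g : ℝ} (hp : 0 ≤ p)
    (hq : 0 ≤ q) (hpq : p + q = 1) (hg : 0 ≤ g) :
    Real.exp (g * (1 - g / 2) * a - (a + b : ℕ) * (g * p)) * (p ^ a * q ^ b) ≤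
      maxLikelihood a b := by
  have h := pow_mul_likelihood_le hab hp hq hpq (t := 1 + g) (by linarith)
  have he : Real.exp (g * (1 - g / 2)) ≤ 1 + g := by
    rw [← Real.le_log_iff_exp_le (by linarith)]
    refine le_trans ?_ (Real.le_log_one_add_of_nonneg hg)
    rw [le_div_iff₀ (by linarith)]
    nlinarith [pow_nonneg hg 3]
  rw [Real.exp_sub, mul_comm _ (a : ℝ), Real.exp_nat_mul, div_mul_eq_mul_div,
    div_le_iff₀ (Real.exp_pos _)]
  calc _ ≤ (1 + g) ^ a * (p ^ a * q ^ b) := by gcongr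
    _ ≤ _ := h
    _ = _ := by congr 2; ring

/-- Change of measure (Donsker–Varadhan) for finite index sets. -/
theorem sum_mul_le_klDiv_add_log {ι : Type*} [Fintype ι] {π ρ g : ι → ℝ} {M : ℝ}
    (hπ : ∀ i, 0 < π i) (hρ : ∀ i, 0 ≤ ρ i) (hρ1 : ∑ i, ρ i = 1) (hM : 0 < M)
    (h : ∑ i, π i * Real.exp (g i) ≤ M) :
    ∑ i, ρ i * g i ≤ ∑ i, ρ i * Real.log (ρ i / π i) + Real.log M := by
  have hterm (i : ι) : ρ i * g i - ρ i * Real.log (ρ i / π i) - ρ i * Real.log M ≤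
      π i * Real.exp (g i) / M - ρ i := by
    rcases (hρ i).eq_or_lt with h0 | h0
    · rw [← h0]
      have := hπ i
      simp only [zero_mul, sub_zero]
      positivity
    · have hpos : 0 < π i * Real.exp (g i) / (ρ i * M) := by
        have := hπ i
        positivity
      have h1 := Real.log_le_sub_one_of_pos hpos
      rw [Real.log_div (by have := hπ i; positivity) (by positivity),
        Real.log_mul (hπ i).ne' (by positivity), Real.log_mul h0.ne' hM.ne', Real.log_exp] at h1
      rw [Real.log_div h0.ne' (hπ i).ne']
      have h2 := mul_le_mul_of_nonneg_left h1 h0.le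
      have h3 : ρ i * (π i * Real.exp (g i) / (ρ i * M) - 1) =
          π i * Real.exp (g i) / M - ρ i := by field_simp
      linarith
  have hsum := sum_le_sum fun i (_ : i ∈ univ) => hterm i
  rw [sum_sub_distrib, sum_sub_distrib, sum_sub_distrib, ← sum_mul, ← sum_div, hρ1] at hsum
  have := (div_le_one hM).2 h
  linarith

open Classical in
/-- The set of draws of the sample `S` that fall into `A`. -/
noncomputable def hits {Z : Type*} {n : ℕ} (A : Set Z) (S : Fin n → Z) : Finset (Fin n) :=
  {k | S k ∈ A}

theorem card_hits_le {Z : Type*} {n : ℕ} (A : Set Z) (S : Fin n → Z) : #(hits A S) ≤ n := by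
  simpa using card_le_univ (hits A S)

theorem setOf_hits_eq {Z : Type*} {n : ℕ} (A : Set Z) (T : Finset (Fin n)) :
    {S : Fin n → Z | hits A S = T} = Set.univ.pi fun k => if k ∈ T then A else Aᶜ := by
  ext S
  simp only [Set.mem_ofPred_eq, Set.mem_univ_pi, Finset.ext_iff, hits, mem_filter_univ]
  refine forall_congr' fun k => ?_
  by_cases hk : k ∈ T <;> simp [hk]

theorem measurableSet_hits_eq {Z : Type*} [MeasurableSpace Z] {n : ℕ} {A : Set Z}
    (hA : MeasurableSet A) (T : Finset (Fin n)) :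
    MeasurableSet {S : Fin n → Z | hits A S = T} := by
  rw [setOf_hits_eq]
  exact MeasurableSet.univ_pi fun k => by split_ifs <;> measurability

theorem pi_hits_eq {Z : Type*} [MeasurableSpace Z] (μ : Measure Z) [SigmaFinite μ] {n : ℕ}
    (A : Set Z) (T : Finset (Fin n)) :
    (Measure.pi fun _ : Fin n => μ) {S | hits A S = T} = μ A ^ #T * μ Aᶜ ^ (n - #T) := by
  rw [setOf_hits_eq, Measure.pi_pi]
  simp only [apply_ite μ, prod_ite, prod_const]
  congr 2
  · simp
  · rw [filter_not, ← compl_eq_univ_sdiff, card_compl]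
    simp

/-- The likelihood ratio between the maximum likelihood model and the true one, for the number
of draws of the sample `S` that fall into `A`. -/
noncomputable def likelihoodRatio {Z : Type*} [MeasurableSpace Z] (μ : Measure Z) {n : ℕ}
    (A : Set Z) (S : Fin n → Z) : ENNReal :=
  ENNReal.ofReal (maxLikelihood #(hits A S) (n - #(hits A S))) /
    (μ A ^ #(hits A S) * μ Aᶜ ^ (n - #(hits A S)))

theorem likelihoodRatio_eq_sum {Z : Type*} [MeasurableSpace Z] (μ : Measure Z) {n : ℕ}
    (A : Set Z) (S : Fin n → Z) :
    likelihoodRatio μ A S = ∑ T : Finset (Fin n), {S | hits A S = T}.indicator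
      (fun _ => ENNReal.ofReal (maxLikelihood #T (n - #T)) / (μ A ^ #T * μ Aᶜ ^ (n - #T))) S := by
  classical
  simp only [Set.indicator_apply, Set.mem_ofPred_eq, sum_ite_eq, mem_univ, if_true]
  rfl

theorem measurable_likelihoodRatio {Z : Type*} [MeasurableSpace Z] (μ : Measure Z) {n : ℕ}
    {A : Set Z} (hA : MeasurableSet A) :
    Measurable (likelihoodRatio μ A : (Fin n → Z) → ENNReal) := by
  rw [funext (likelihoodRatio_eq_sum μ A)]
  exact Finset.measurable_fun_sum _ fun T _ =>
    measurable_const.indicator (measurableSet_hits_eq hA T)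

theorem lintegral_likelihoodRatio_le {Z : Type*} [MeasurableSpace Z] (μ : Measure Z)
    [IsProbabilityMeasure μ] {n : ℕ} (hn : 1 ≤ n) {A : Set Z} (hA : MeasurableSet A) :
    ∫⁻ S, likelihoodRatio μ A S ∂(Measure.pi fun _ : Fin n => μ) ≤ ENNReal.ofReal (2 * √n) := by
  simp only [likelihoodRatio_eq_sum]
  rw [lintegral_finsetSum _ fun T _ =>
    measurable_const.indicator (measurableSet_hits_eq hA T)]
  calc _ ≤ ∑ T : Finset (Fin n), ENNReal.ofReal (maxLikelihood #T (n - #T)) := by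
        refine sum_le_sum fun T _ => ?_
        rw [lintegral_indicator_const (measurableSet_hits_eq hA T), pi_hits_eq]
        rw [mul_comm]
        exact ENNReal.mul_div_le
    _ = ENNReal.ofReal (∑ T : Finset (Fin n), maxLikelihood #T (n - #T)) :=
        (ENNReal.ofReal_sum_of_nonneg fun T _ => (maxLikelihood_pos _ _).le).symm
    _ ≤ _ := by
        refine ENNReal.ofReal_le_ofReal ?_
        rw [← powerset_univ, sum_powerset_apply_card fun k => maxLikelihood k (n - k), card_fin]
        have h := sum_choose_mul_maxLikelihood_le hn
        rw [Finset.Nat.sum_antidiagonal_eq_sum_range_succ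
          fun i j => (n.choose i : ℝ) * maxLikelihood i j] at h
        simpa using h

theorem ofReal_exp_le_likelihoodRatio {Z : Type*} [MeasurableSpace Z] (μ : Measure Z)
    [IsProbabilityMeasure μ] {n : ℕ} {A : Set Z} (S : Fin n → Z) {x : ℝ}
    (h : Real.exp x * (μ.real A ^ #(hits A S) * μ.real Aᶜ ^ (n - #(hits A S))) ≤
      maxLikelihood #(hits A S) (n - #(hits A S))) :
    ENNReal.ofReal (Real.exp x) ≤ likelihoodRatio μ A S := by
  have hpos := maxLikelihood_pos #(hits A S) (n - #(hits A S))
  rw [likelihoodRatio, ENNReal.le_div_iff_mul_le (Or.inr (by simpa using hpos))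
    (Or.inr ENNReal.ofReal_ne_top), ← ofReal_measureReal (s := A),
    ← ofReal_measureReal (s := Aᶜ), ← ENNReal.ofReal_pow measureReal_nonneg,
    ← ENNReal.ofReal_pow measureReal_nonneg, ← ENNReal.ofReal_mul (by positivity),
    ← ENNReal.ofReal_mul (by positivity)]
  exact ENNReal.ofReal_le_ofReal h

theorem ofReal_exp_upper_le_likelihoodRatio {Z : Type*} [MeasurableSpace Z] (μ : Measure Z)
    [IsProbabilityMeasure μ] {n : ℕ} (hn : 1 ≤ n) {A : Set Z} (hA : MeasurableSet A)
    (S : Fin n → Z) {l : ℝ} (hl : 0 ≤ l) :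
    ENNReal.ofReal (Real.exp (n * (l * (1 - l / 2) * μ.real A) - l * #(hits A S))) ≤
      likelihoodRatio μ A S := by
  have hc := Nat.add_sub_of_le (card_hits_le A S)
  have h := exp_mul_likelihood_le_upper (a := #(hits A S)) (b := n - #(hits A S)) (by omega)
    (measureReal_nonneg (μ := μ) (s := A)) (measureReal_nonneg (μ := μ) (s := Aᶜ))
    (probReal_add_probReal_compl hA) hl
  rw [hc] at h
  exact ofReal_exp_le_likelihoodRatio μ S h

theorem ofReal_exp_lower_le_likelihoodRatio {Z : Type*} [MeasurableSpace Z] (μ : Measure Z)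
    [IsProbabilityMeasure μ] {n : ℕ} (hn : 1 ≤ n) {A : Set Z} (hA : MeasurableSet A)
    (S : Fin n → Z) {g : ℝ} (hg : 0 ≤ g) :
    ENNReal.ofReal (Real.exp (g * (1 - g / 2) * #(hits A S) - n * (g * μ.real A))) ≤
      likelihoodRatio μ A S := by
  have hc := Nat.add_sub_of_le (card_hits_le A S)
  have h := exp_mul_likelihood_le_lower (a := #(hits A S)) (b := n - #(hits A S)) (by omega)
    (measureReal_nonneg (μ := μ) (s := A)) (measureReal_nonneg (μ := μ) (s := Aᶜ))
    (probReal_add_probReal_compl hA) hg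
  rw [hc] at h
  exact ofReal_exp_le_likelihoodRatio μ S h

/-- The PAC-Bayesian change of measure: outside an event of probability at most `δ`, every
exponent family dominated by the likelihood ratios is controlled simultaneously for all `ρ`. -/
theorem exists_pacBayes_event {Z ι : Type*} [MeasurableSpace Z] [Fintype ι] (μ : Measure Z)
    [IsProbabilityMeasure μ] {n : ℕ} (hn : 1 ≤ n) {A : ι → Set Z} (hA : ∀ i, MeasurableSet (A i))
    {π : ι → ℝ} (hπ : ∀ i, 0 < π i) (hπ1 : ∑ i, π i = 1) {δ : ℝ} (hδ : 0 < δ) :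
    ∃ B : Set (Fin n → Z), (Measure.pi fun _ : Fin n => μ) B ≤ ENNReal.ofReal δ ∧
      ∀ S ∉ B, ∀ ρ : ι → ℝ, (∀ i, 0 ≤ ρ i) → ∑ i, ρ i = 1 → ∀ f : ι → ℝ,
        (∀ i, ENNReal.ofReal (Real.exp (f i)) ≤ likelihoodRatio μ (A i) S) →
          ∑ i, ρ i * f i ≤ ∑ i, ρ i * Real.log (ρ i / π i) + Real.log (2 * √n / δ) := by
  have hn0 : (0 : ℝ) < n := by exact_mod_cast hn
  have hM : 0 < 2 * √n / δ := by positivity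
  let F : (Fin n → Z) → ENNReal := fun S => ∑ i, ENNReal.ofReal (π i) * likelihoodRatio μ (A i) S
  have hF : Measurable F := Finset.measurable_fun_sum _ fun i _ =>
    (measurable_likelihoodRatio μ (hA i)).const_mul _
  have hint : ∫⁻ S, F S ∂(Measure.pi fun _ : Fin n => μ) ≤ ENNReal.ofReal (2 * √n) := by
    rw [lintegral_finsetSum _ fun i _ => (measurable_likelihoodRatio μ (hA i)).const_mul _]
    calc _ ≤ ∑ i, ENNReal.ofReal (π i) * ENNReal.ofReal (2 * √n) := by
          refine sum_le_sum fun i _ => ?_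
          rw [lintegral_const_mul _ (measurable_likelihoodRatio μ (hA i))]
          gcongr
          exact lintegral_likelihoodRatio_le μ hn (hA i)
      _ = _ := by
          rw [← sum_mul, ← ENNReal.ofReal_sum_of_nonneg fun i _ => (hπ i).le, hπ1]
          simp
  refine ⟨{S | ENNReal.ofReal (2 * √n / δ) ≤ F S}, ?_, ?_⟩
  · refine (meas_ge_le_lintegral_div hF.aemeasurable (by simpa using hM)
      ENNReal.ofReal_ne_top).trans ?_
    refine (ENNReal.div_le_div_right hint _).trans ?_
    rw [← ENNReal.ofReal_div_of_pos hM]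
    refine ENNReal.ofReal_le_ofReal (le_of_eq ?_)
    field_simp
  · intro S hS ρ hρ hρ1 f hf
    refine sum_mul_le_klDiv_add_log hπ hρ hρ1 hM ?_
    rw [Set.mem_ofPred_eq, not_le] at hS
    rw [← ENNReal.ofReal_le_ofReal_iff hM.le,
      ENNReal.ofReal_sum_of_nonneg fun i _ => mul_nonneg (hπ i).le (Real.exp_pos _).le]
    refine le_trans (sum_le_sum fun i _ => ?_) hS.le
    rw [ENNReal.ofReal_mul (hπ i).le]
    gcongr
    exact hf i

theorem card_hits_eq_sum {Z : Type*} {n : ℕ} (A : Set Z) [DecidablePred (· ∈ A)]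
    (S : Fin n → Z) : (#(hits A S) : ℝ) = ∑ k, if S k ∈ A then (1 : ℝ) else 0 := by
  classical
  rw [sum_boole, hits]
  congr!

theorem sum_mul_sum_klDiv {ι : Type*} [Fintype ι] {π ρ : ι → ℝ} (hπ : ∀ i, 0 < π i)
    (hρ1 : ∑ i, ρ i = 1) :
    ∑ ij : ι × ι, ρ ij.1 * ρ ij.2 * Real.log (ρ ij.1 * ρ ij.2 / (π ij.1 * π ij.2)) =
      2 * ∑ i, ρ i * Real.log (ρ i / π i) := by
  have h (i j : ι) : ρ i * ρ j * Real.log (ρ i * ρ j / (π i * π j)) =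
      ρ j * (ρ i * Real.log (ρ i / π i)) + ρ i * (ρ j * Real.log (ρ j / π j)) := by
    rcases eq_or_ne (ρ i) 0 with hi | hi
    · simp [hi]
    rcases eq_or_ne (ρ j) 0 with hj | hj
    · simp [hj]
    rw [mul_div_mul_comm, Real.log_mul (div_ne_zero hi (hπ i).ne') (div_ne_zero hj (hπ j).ne')]
    ring
  rw [Fintype.sum_prod_type]
  simp only [h, sum_add_distrib, ← mul_sum, ← sum_mul, hρ1]
  ring

/-- The second-order oracle bound for the binary majority vote, pointwise. -/
theorem ite_ne_le_of_card_eq_two {Y ι : Type*} [Fintype Y] (hY : Fintype.card Y = 2)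
    [DecidableEq Y] [Fintype ι] {ρ : ι → ℝ} (hρ1 : ∑ i, ρ i = 1) (v : ι → Y) {z y : Y}
    (hz : ∑ i, ρ i * (if v i = y then (1 : ℝ) else 0) ≤
      ∑ i, ρ i * (if v i = z then (1 : ℝ) else 0)) :
    (if z ≠ y then (1 : ℝ) else 0) ≤ 4 * ∑ i, ρ i * (if v i ≠ y then (1 : ℝ) else 0) -
      2 * ∑ i, ∑ j, ρ i * ρ j * (if v i ≠ v j then (1 : ℝ) else 0) := by
  have hbin {a b c : Y} (hab : a ≠ c) (hbc : b ≠ c) : a = b := by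
    by_contra h
    have := card_le_univ ({a, b, c} : Finset Y)
    rw [card_eq_three.2 ⟨a, b, c, h, hab, hbc, rfl⟩] at this
    omega
  set s := ∑ i, ρ i * (if v i ≠ y then (1 : ℝ) else 0) with hs
  have hdis (i j : ι) : ρ i * ρ j * (if v i ≠ v j then (1 : ℝ) else 0) =
      ρ i * (if v i ≠ y then (1 : ℝ) else 0) * ρ j +
      ρ i * (ρ j * (if v j ≠ y then (1 : ℝ) else 0)) -
      2 * ((ρ i * (if v i ≠ y then (1 : ℝ) else 0)) *
        (ρ j * (if v j ≠ y then (1 : ℝ) else 0))) := by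
    by_cases hi : v i = y <;> by_cases hj : v j = y
    · simp [hi, hj]
    · simp [hi, hj, Ne.symm hj]
    · simp [hi, hj]
    · simp [hj, hbin hi hj]
      ring
  have hD : ∑ i, ∑ j, ρ i * ρ j * (if v i ≠ v j then (1 : ℝ) else 0) = 2 * s - 2 * s ^ 2 := by
    simp only [hdis, sum_sub_distrib, sum_add_distrib, ← mul_sum, ← sum_mul, hρ1, ← hs]
    ring
  rw [hD]
  split_ifs with hzy
  · have hcompl : ∑ i, ρ i * (if v i = y then (1 : ℝ) else 0) = 1 - s := by
      rw [eq_sub_iff_add_eq, hs, ← sum_add_distrib]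
      refine Eq.trans ?_ hρ1
      refine sum_congr rfl fun i _ => ?_
      by_cases hi : v i = y <;> simp [hi]
    have hle : ∑ i, ρ i * (if v i = z then (1 : ℝ) else 0) = s := by
      refine sum_congr rfl fun i _ => ?_
      by_cases hi : v i = z
      · simp [hi, hzy]
      · have : v i = y := hbin hi (Ne.symm hzy)
        simp [this, Ne.symm hzy]
    rw [hcompl, hle] at hz
    nlinarith
  · nlinarith [sq_nonneg s]

theorem integral_ite_one_zero {Z : Type*} [MeasurableSpace Z] (μ : Measure Z) {p : Z → Prop}
    [DecidablePred p] (hp : MeasurableSet {z | p z}) :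
    ∫ z, (if p z then (1 : ℝ) else 0) ∂μ = μ.real {z | p z} := by
  rw [← integral_indicator_one hp]
  simp [Set.indicator_apply]

theorem integrable_ite_one_zero {Z : Type*} [MeasurableSpace Z] (μ : Measure Z)
    [IsFiniteMeasure μ] {p : Z → Prop} [DecidablePred p] (hp : MeasurableSet {z | p z}) :
    Integrable (fun z => if p z then (1 : ℝ) else 0) μ := by
  refine ((integrable_const (μ := μ) (1 : ℝ)).indicator hp).congr (.of_forall fun z => ?_)
  simp [Set.indicator_apply]

/-- The second-order oracle bound on the loss of the majority vote in binary classification. -/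
theorem majorityVote_loss_le {X Y ι : Type*} [MeasurableSpace X] [MeasurableSpace Y]
    [MeasurableSingletonClass Y] [Fintype Y] (hY : Fintype.card Y = 2) [DecidableEq Y]
    [Fintype ι] (D : Measure (X × Y)) [IsProbabilityMeasure D] {hyp : ι → X → Y}
    (hmeas : ∀ i, Measurable (hyp i)) {ρ : ι → ℝ} (hρ1 : ∑ i, ρ i = 1) {mv : X → Y}
    (hmvm : Measurable mv)
    (hmv : ∀ x y, ∑ i, ρ i * (if hyp i x = y then (1 : ℝ) else 0) ≤
      ∑ i, ρ i * (if hyp i x = mv x then (1 : ℝ) else 0)) :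
    D.real {p | mv p.1 ≠ p.2} ≤ 4 * ∑ i, ρ i * D.real {p | hyp i p.1 ≠ p.2} -
      2 * ∑ i, ∑ j, ρ i * ρ j * (D.map Prod.fst).real {x | hyp i x ≠ hyp j x} := by
  have hloss {f : X → Y} (hf : Measurable f) : MeasurableSet {p : X × Y | f p.1 ≠ p.2} :=
    (measurableSet_eq_fun (hf.comp measurable_fst) measurable_snd).compl
  have hdis (i j : ι) : MeasurableSet {x | hyp i x ≠ hyp j x} :=
    (measurableSet_eq_fun (hmeas i) (hmeas j)).compl
  have hdis' (i j : ι) : MeasurableSet {p : X × Y | hyp i p.1 ≠ hyp j p.1} :=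
    measurable_fst (hdis i j)
  have hmap (i j : ι) : (D.map Prod.fst).real {x | hyp i x ≠ hyp j x} =
      D.real {p | hyp i p.1 ≠ hyp j p.1} :=
    map_measureReal_apply measurable_fst (hdis i j)
  have hint1 (i : ι) : Integrable
      (fun p : X × Y => ρ i * (if hyp i p.1 ≠ p.2 then (1 : ℝ) else 0)) D :=
    (integrable_ite_one_zero D (hloss (hmeas i))).const_mul _
  have hint2 (i j : ι) : Integrable
      (fun p : X × Y => ρ i * ρ j * (if hyp i p.1 ≠ hyp j p.1 then (1 : ℝ) else 0)) D :=
    (integrable_ite_one_zero D (hdis' i j)).const_mul _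
  have hI1 := (integrable_finsetSum univ fun i _ => hint1 i).const_mul 4
  have hI2 := (integrable_finsetSum univ fun i _ =>
    integrable_finsetSum univ fun j _ => hint2 i j).const_mul 2
  have h := integral_mono (integrable_ite_one_zero D (hloss hmvm)) (hI1.sub hI2)
    fun p => ite_ne_le_of_card_eq_two hY hρ1 (fun i => hyp i p.1) (hmv p.1 p.2)
  rw [integral_ite_one_zero D (hloss hmvm)] at h
  refine h.trans (le_of_eq ?_)
  simp only [Pi.sub_apply]
  rw [integral_sub hI1 hI2, integral_const_mul, integral_const_mul,
    integral_finsetSum _ fun i _ => hint1 i,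
    integral_finsetSum _ fun i _ => integrable_finsetSum univ fun j _ => hint2 i j]
  congr 2
  · refine sum_congr rfl fun i _ => ?_
    rw [integral_const_mul, integral_ite_one_zero D (hloss (hmeas i))]
  · refine sum_congr rfl fun i _ => ?_
    rw [integral_finsetSum _ fun j _ => hint2 i j]
    refine sum_congr rfl fun j _ => ?_
    rw [integral_const_mul, integral_ite_one_zero D (hdis' i j), hmap]

/-- The PAC-Bayes-`λ` bounds, from above and from below, outside an event of probability at
most `δ`. -/
theorem exists_pacBayes_lambda_event {Z ι : Type*} [MeasurableSpace Z] [Fintype ι]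
    (μ : Measure Z) [IsProbabilityMeasure μ] {n : ℕ} (hn : 1 ≤ n) {A : ι → Set Z}
    (hA : ∀ i, MeasurableSet (A i)) [∀ i, DecidablePred (· ∈ A i)] {π : ι → ℝ}
    (hπ : ∀ i, 0 < π i) (hπ1 : ∑ i, π i = 1) {δ : ℝ} (hδ : 0 < δ) :
    ∃ B : Set (Fin n → Z), (Measure.pi fun _ : Fin n => μ) B ≤ ENNReal.ofReal δ ∧
      ∀ S ∉ B, ∀ ρ : ι → ℝ, (∀ i, 0 ≤ ρ i) → ∑ i, ρ i = 1 →
        (∀ l : ℝ, 0 < l → l < 2 → ∑ i, ρ i * μ.real (A i) ≤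
          (∑ i, ρ i * ((n : ℝ)⁻¹ * ∑ k, if S k ∈ A i then (1 : ℝ) else 0)) / (1 - l / 2) +
          (∑ i, ρ i * Real.log (ρ i / π i) + Real.log (2 * √n / δ)) / (l * (1 - l / 2) * n)) ∧
        ∀ g : ℝ, 0 < g →
          (1 - g / 2) * (∑ i, ρ i * ((n : ℝ)⁻¹ * ∑ k, if S k ∈ A i then (1 : ℝ) else 0)) -
          (∑ i, ρ i * Real.log (ρ i / π i) + Real.log (2 * √n / δ)) / (g * n) ≤
          ∑ i, ρ i * μ.real (A i) := by
  obtain ⟨B, hB, h⟩ := exists_pacBayes_event μ hn hA hπ hπ1 hδ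
  refine ⟨B, hB, fun S hS ρ hρ hρ1 => ?_⟩
  have hn0 : (0 : ℝ) < n := by exact_mod_cast hn
  have hemp : ∑ i, ρ i * ((n : ℝ)⁻¹ * ∑ k, if S k ∈ A i then (1 : ℝ) else 0) =
      (∑ i, ρ i * #(hits (A i) S)) / n := by
    rw [sum_div]
    refine sum_congr rfl fun i _ => ?_
    rw [card_hits_eq_sum]
    ring
  rw [hemp]
  refine ⟨fun l hl0 hl2 => ?_, fun g hg => ?_⟩
  · have hl : 0 < 1 - l / 2 := by linarith
    have := h S hS ρ hρ hρ1 _ fun i => ofReal_exp_upper_le_likelihoodRatio μ hn (hA i) S hl0.le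
    have hlin : ∑ i, ρ i * (n * (l * (1 - l / 2) * μ.real (A i)) - l * #(hits (A i) S)) =
        l * (1 - l / 2) * n * (∑ i, ρ i * μ.real (A i)) - l * ∑ i, ρ i * #(hits (A i) S) := by
      rw [mul_sum, mul_sum, ← sum_sub_distrib]
      exact sum_congr rfl fun i _ => by ring
    rw [hlin] at this
    have heq (a b : ℝ) : a / n / (1 - l / 2) + b / (l * (1 - l / 2) * n) =
        (l * a + b) / (l * (1 - l / 2) * n) := by
      have := hl.ne'
      field_simp
    rw [heq, le_div_iff₀ (by positivity)]
    linarith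
  · have := h S hS ρ hρ hρ1 _ fun i => ofReal_exp_lower_le_likelihoodRatio μ hn (hA i) S hg.le
    have hlin : ∑ i, ρ i * (g * (1 - g / 2) * #(hits (A i) S) - n * (g * μ.real (A i))) =
        g * (1 - g / 2) * (∑ i, ρ i * #(hits (A i) S)) - g * n * ∑ i, ρ i * μ.real (A i) := by
      rw [mul_sum, mul_sum, ← sum_sub_distrib]
      exact sum_congr rfl fun i _ => by ring
    rw [hlin] at this
    have heq (a b : ℝ) : (1 - g / 2) * (a / n) - b / (g * n) =
        (g * (1 - g / 2) * a - b) / (g * n) := by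
      field_simp
    rw [heq, div_le_iff₀ (by positivity)]
    linarith

/-- PAC-Bayesian disagreement bound for binary classification: with probability at least
`1 - δ` over the joint draw of a labeled sample of size `n` from `D` and an unlabeled
sample of size `m` from the marginal `D_X`, simultaneously for all posteriors `ρ`, all
`λ ∈ (0,2)` and all `γ > 0`, the stated bound on `L(MV_ρ)` holds. -/
theorem pac_bayes_disagreement_bound_binary
    {X Y H : Type*} [MeasurableSpace X] [MeasurableSpace Y] [MeasurableSingletonClass Y]
    [Fintype Y] (hY : Fintype.card Y = 2) [DecidableEq Y] [Fintype H]
    (D : Measure (X × Y)) [IsProbabilityMeasure D]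
    (hyp : H → X → Y) (hmeas : ∀ i, Measurable (hyp i))
    (n m : ℕ) (hn : 1 ≤ n) (hm : 1 ≤ m)
    (π : H → ℝ) (hπ0 : ∀ i, 0 < π i) (hπ1 : ∑ i, π i = 1)
    (δ : ℝ) (hδ0 : 0 < δ) (hδ1 : δ < 1)
    (MV : (H → ℝ) → X → Y) (hMVmeas : ∀ ρ, Measurable (MV ρ))
    (hMV : ∀ ρ : H → ℝ, (∀ i, 0 ≤ ρ i) → (∑ i, ρ i) = 1 → ∀ x y,
      (∑ i, ρ i * (if hyp i x = y then (1:ℝ) else 0)) ≤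
        ∑ i, ρ i * (if hyp i x = MV ρ x then (1:ℝ) else 0)) :
    ENNReal.ofReal (1 - δ) ≤
      ((Measure.pi fun _ : Fin n => D).prod
          (Measure.pi fun _ : Fin m => D.map Prod.fst))
        {SS : (Fin n → X × Y) × (Fin m → X) |
          ∀ ρ : H → ℝ, (∀ i, 0 ≤ ρ i) → (∑ i, ρ i) = 1 →
            ∀ l : ℝ, 0 < l → l < 2 → ∀ g : ℝ, 0 < g →
              (D {p : X × Y | MV ρ p.1 ≠ p.2}).toReal ≤
                4 * ((∑ i, ρ i * ((n : ℝ)⁻¹ *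
                      ∑ k, if hyp i (SS.1 k).1 ≠ (SS.1 k).2 then (1:ℝ) else 0)) /
                        (1 - l / 2) +
                    ((∑ i, ρ i * Real.log (ρ i / π i)) +
                        Real.log (4 * Real.sqrt n / δ)) / (l * (1 - l / 2) * n)) -
                2 * ((1 - g / 2) * (∑ i, ∑ j, ρ i * ρ j * ((m : ℝ)⁻¹ *
                      ∑ k, if hyp i (SS.2 k) ≠ hyp j (SS.2 k) then (1:ℝ) else 0)) -
                    (2 * (∑ i, ρ i * Real.log (ρ i / π i)) +
                        Real.log (4 * Real.sqrt m / δ)) / (g * m))} := by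
  have hlog (k : ℕ) : 4 * √(k : ℝ) / δ = 2 * √(k : ℝ) / (δ / 2) := by field_simp; ring
  have : IsProbabilityMeasure (D.map Prod.fst) :=
    Measure.isProbabilityMeasure_map measurable_fst.aemeasurable
  obtain ⟨B₁, hB₁, h₁⟩ := exists_pacBayes_lambda_event D hn
    (A := fun i => {p : X × Y | hyp i p.1 ≠ p.2})
    (fun i => (measurableSet_eq_fun ((hmeas i).comp measurable_fst) measurable_snd).compl)
    hπ0 hπ1 (half_pos hδ0)
  obtain ⟨B₂, hB₂, h₂⟩ := exists_pacBayes_lambda_event (D.map Prod.fst) hm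
    (A := fun ij : H × H => {x | hyp ij.1 x ≠ hyp ij.2 x})
    (fun ij => (measurableSet_eq_fun (hmeas ij.1) (hmeas ij.2)).compl)
    (π := fun ij => π ij.1 * π ij.2) (fun ij => mul_pos (hπ0 ij.1) (hπ0 ij.2))
    (by rw [Fintype.sum_prod_type]; simp [← mul_sum, hπ1]) (half_pos hδ0)
  set P := (Measure.pi fun _ : Fin n => D).prod (Measure.pi fun _ : Fin m => D.map Prod.fst)
  have hbad : P (B₁ ×ˢ Set.univ ∪ Set.univ ×ˢ B₂) ≤ ENNReal.ofReal δ := by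
    refine (measure_union_le _ _).trans ?_
    rw [Measure.prod_prod, Measure.prod_prod, measure_univ, measure_univ, mul_one, one_mul]
    refine (add_le_add hB₁ hB₂).trans ?_
    rw [← ENNReal.ofReal_add (half_pos hδ0).le (half_pos hδ0).le, add_halves]
  have hcompl : ENNReal.ofReal (1 - δ) ≤ P (B₁ ×ˢ Set.univ ∪ Set.univ ×ˢ B₂)ᶜ := by
    rw [ENNReal.ofReal_sub _ hδ0.le, ENNReal.ofReal_one, tsub_le_iff_right,
      ← measure_univ (μ := P), ← Set.compl_union_self (B₁ ×ˢ Set.univ ∪ Set.univ ×ˢ B₂)]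
    exact (measure_union_le _ _).trans (by gcongr)
  refine hcompl.trans (measure_mono ?_)
  rintro ⟨S, S'⟩ hS ρ hρ hρ1 l hl0 hl2 g hg
  simp only [Set.mem_compl_iff, Set.mem_union, Set.mem_prod, Set.mem_univ, and_true, true_and,
    not_or] at hS
  have hloss := majorityVote_loss_le hY D hmeas hρ1 (hMVmeas ρ) (hMV ρ hρ hρ1)
  have hgibbs := (h₁ S hS.1 ρ hρ hρ1).1 l hl0 hl2
  have hdis := (h₂ S' hS.2 (fun ij => ρ ij.1 * ρ ij.2) (fun ij => mul_nonneg (hρ _) (hρ _))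
    (by rw [Fintype.sum_prod_type]; simp [← mul_sum, hρ1])).2 g hg
  rw [sum_mul_sum_klDiv hπ0 hρ1] at hdis
  simp only [Fintype.sum_prod_type, ← hlog, Set.mem_ofPred_eq] at hgibbs hdis
  change D.real _ ≤ _
  linarith
end
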